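/- arXiv:1207.6522 — 2 statements merged into one kernel-verified Lean document; each statement's English description precedes it below -/
import Mathlib

section
/- Let u, v be words, let I₁ ⊔ J₁ = {1,...,|u|} and I₂ ⊔ J₂ = {|u|+1,...,|u|+|v|} be partitions, and set I'₂ = {k − |u| : k ∈ I₂}, J'₂ = {k − |u| : k ∈ J₂}. Then pack((u*v)[J₁ ∪ J₂] / (u*v)[I₁ ∪ I₂]) = pack(u[J₁]/u[I₁]) * pack(v[J'₂]/v[I'₂]). -/
/-- Words over the alphabet `X = {x_i : i ≥ 0}`, identified with lists of natural numbers. -/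
abbrev Word : Type := List ℕ

/-- `IAlph w` is the set of indices of letters occurring in `w`. -/
def IAlph (w : Word) : Finset ℕ := w.toFinset

/-- `wsup w` is the supremum of `IAlph w` (0 for the empty word). -/
def wsup (w : Word) : ℕ := w.foldr max 0

/-- The substitution `S_φ` replaces each letter `x_i` by `x_{φ i}`. -/
def subst (φ : ℕ → ℕ) (w : Word) : Word := w.map φ

/-- The packing substitution `φ_w`: it sends the `m`-th smallest nonzero letter of `w` to `m`,
and `0` to `0`. -/
def packMap (w : Word) (i : ℕ) : ℕ := (((IAlph w).erase 0).filter (fun j => j ≤ i)).card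

/-- `pack w = S_{φ_w} w`. -/
def pack (w : Word) : Word := subst (packMap w) w

/-- A word is packed if `pack w = w`. -/
def IsPacked (w : Word) : Prop := pack w = w

/-- `T_t`: shift every nonzero letter by `t`, fixing `x_0`. -/
def shiftW (t : ℕ) (w : Word) : Word := subst (fun n => if n = 0 then 0 else n + t) w

/-- Shifted concatenation `u * v = u · T_{sup u}(v)`. -/
def sc (u v : Word) : Word := u ++ shiftW (wsup u) v

/-- `w[I]`: the subword of `w` formed by the letters at the (1-indexed) positions in `I`,
taken in increasing order of position. -/
def subword (w : Word) (I : Finset ℕ) : Word :=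
  ((List.range w.length).filter (fun j => decide (j + 1 ∈ I))).map (fun j => w.getD j 0)

/-- Quotient by a set of indices: `w / A = S_{φ_A} w` where `φ_A i = 0` if `i ∈ A`, else `i`. -/
def quotSet (w : Word) (A : Finset ℕ) : Word := subst (fun i => if i ∈ A then 0 else i) w

/-- Quotient by a word: `w / u = w / IAlph u`. -/
def quotWord (w u : Word) : Word := quotSet w (IAlph u)

theorem subword_append {u v : Word} {I I₁ I₂ : Finset ℕ}
    (h₁ : ∀ j < u.length, (j + 1 ∈ I ↔ j + 1 ∈ I₁))
    (h₂ : ∀ j < v.length, (u.length + j + 1 ∈ I ↔ j + 1 ∈ I₂)) :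
    subword (u ++ v) I = subword u I₁ ++ subword v I₂ := by
  unfold subword
  rw [List.length_append, List.range_add, List.filter_append, List.map_append, List.filter_map,
    List.map_map]
  congr 1
  · rw [List.filter_congr (q := fun j => decide (j + 1 ∈ I₁))
      (fun j hj => by simp [h₁ j (List.mem_range.1 hj)])]
    refine List.map_congr_left fun j hj => ?_
    exact List.getD_append _ _ _ _ (List.mem_range.1 (List.mem_filter.1 hj).1)
  · rw [List.filter_congr (q := fun j => decide (j + 1 ∈ I₂))
      (fun j hj => by simp [h₂ j (List.mem_range.1 hj)])]
    refine List.map_congr_left fun j _ => ?_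
    exact (List.getD_append_right _ _ _ _ (Nat.le_add_right _ _)).trans (by simp)

theorem subword_subst {φ : ℕ → ℕ} (hφ : φ 0 = 0) (w : Word) (I : Finset ℕ) :
    subword (subst φ w) I = subst φ (subword w I) := by
  unfold subword subst
  rw [List.map_map, List.length_map]
  refine List.map_congr_left fun j _ => ?_
  have h := List.getD_map (l := w) (d := 0) (n := j) φ
  rwa [hφ] at h

theorem le_wsup {w : Word} {i : ℕ} (h : i ∈ w) : i ≤ wsup w := by
  induction w with
  | nil => simp at h
  | cons a w ih =>
    simp only [wsup, List.foldr_cons, List.mem_cons] at h ih ⊢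
    grind

theorem wsup_le {w : Word} {n : ℕ} (h : ∀ i ∈ w, i ≤ n) : wsup w ≤ n := by
  induction w with
  | nil => simp [wsup]
  | cons a w ih =>
    exact max_le (h a List.mem_cons_self) (ih fun i hi => h i (List.mem_cons_of_mem a hi))

theorem mem_of_mem_subword {w : Word} {I : Finset ℕ} {i : ℕ} (h : i ∈ subword w I) : i ∈ w := by
  simp only [subword, List.mem_map, List.mem_filter, List.mem_range] at h
  obtain ⟨j, ⟨hj, -⟩, rfl⟩ := h
  rw [List.getD_eq_getElem _ _ hj]
  exact List.getElem_mem hj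

theorem mem_shiftW {t n : ℕ} {w : Word} :
    n ∈ shiftW t w ↔ ∃ i ∈ w, (if i = 0 then 0 else i + t) = n := by
  simp [shiftW, subst]

theorem quotWord_append_shiftW {a b c d : Word} {t : ℕ} (ha : ∀ i ∈ a, i ≤ t)
    (hc : ∀ i ∈ c, i ≤ t) :
    quotWord (a ++ shiftW t b) (c ++ shiftW t d) = quotWord a c ++ shiftW t (quotWord b d) := by
  unfold quotWord quotSet
  rw [subst, List.map_append]
  congr 1
  · refine List.map_congr_left fun i hi => ?_
    have hi' := ha i hi
    simp only [IAlph, List.mem_toFinset, List.mem_append, mem_shiftW]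
    grind
  · simp only [shiftW, subst, List.map_map]
    refine List.map_congr_left fun i _ => ?_
    simp only [Function.comp, IAlph, List.mem_toFinset, List.mem_append]
    grind

theorem packMap_zero (w : Word) : packMap w 0 = 0 := by
  simp only [packMap, Finset.card_eq_zero, Finset.filter_eq_empty_iff, Finset.mem_erase]
  omega

theorem packMap_ne_zero {w : Word} {i : ℕ} (h : i ∈ w) (hi : i ≠ 0) : packMap w i ≠ 0 :=
  Finset.card_ne_zero_of_mem (a := i) (by simp [IAlph, h, hi])

theorem wsup_pack (w : Word) : wsup (pack w) = ((IAlph w).erase 0).card := by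
  apply le_antisymm
  · refine wsup_le fun i hi => ?_
    obtain ⟨j, -, rfl⟩ := List.mem_map.1 hi
    exact Finset.card_filter_le _ _
  · rcases ((IAlph w).erase 0).eq_empty_or_nonempty with h | h
    · simp [h]
    · have hm := Finset.max'_mem _ h
      have hw : ((IAlph w).erase 0).max' h ∈ w := by
        simpa [IAlph] using (Finset.mem_erase.1 hm).2
      refine le_trans (le_of_eq ?_) (le_wsup (List.mem_map_of_mem (f := packMap w) hw))
      rw [packMap, Finset.filter_true_of_mem fun j hj => Finset.le_max' _ j hj]

theorem IAlph_append_shiftW_erase (a b : Word) (t : ℕ) :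
    (IAlph (a ++ shiftW t b)).erase 0 =
      (IAlph a).erase 0 ∪ ((IAlph b).erase 0).image (· + t) := by
  ext n
  simp only [IAlph, Finset.mem_erase, List.mem_toFinset, List.mem_append, mem_shiftW,
    Finset.mem_union, Finset.mem_image]
  grind

theorem packMap_append_shiftW_of_le {a : Word} (b : Word) {t i : ℕ} (hi : i ≤ t) :
    packMap (a ++ shiftW t b) i = packMap a i := by
  unfold packMap
  rw [IAlph_append_shiftW_erase]
  congr 1
  ext n
  simp only [Finset.mem_filter, Finset.mem_union, Finset.mem_image, Finset.mem_erase]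
  grind

theorem packMap_append_shiftW_add {a : Word} (b : Word) {t : ℕ} (ha : ∀ i ∈ a, i ≤ t) (i : ℕ) :
    packMap (a ++ shiftW t b) (i + t) = packMap b i + ((IAlph a).erase 0).card := by
  have ha' : ∀ n ∈ (IAlph a).erase 0, n ≤ t := fun n hn =>
    ha n (by simpa [IAlph] using (Finset.mem_erase.1 hn).2)
  unfold packMap
  rw [IAlph_append_shiftW_erase, Finset.filter_union,
    Finset.filter_true_of_mem fun n hn => (ha' n hn).trans (Nat.le_add_left t i),
    Finset.filter_image, Finset.card_union_of_disjoint,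
    Finset.card_image_of_injective _ (add_left_injective t), add_comm]
  · simp
  · rw [Finset.disjoint_left]
    intro n hn hn'
    have := ha' n hn
    simp only [Finset.mem_image, Finset.mem_filter, Finset.mem_erase] at hn'
    grind

theorem pack_append_shiftW {a : Word} (b : Word) {t : ℕ} (ha : ∀ i ∈ a, i ≤ t) :
    pack (a ++ shiftW t b) = sc (pack a) (pack b) := by
  rw [sc, wsup_pack]
  conv_lhs => rw [pack, subst, List.map_append]
  congr 1
  · exact List.map_congr_left fun i hi => packMap_append_shiftW_of_le b (ha i hi)
  · simp only [pack, shiftW, subst, List.map_map]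
    refine List.map_congr_left fun i hi => ?_
    by_cases h : i = 0
    · simp [h, packMap_zero]
    · simp only [Function.comp, h, packMap_ne_zero hi h, if_false]
      exact packMap_append_shiftW_add b ha i

theorem subword_sc {u v : Word} {I I' : Finset ℕ} (hI : I ⊆ Finset.Icc 1 u.length)
    (hI' : I' ⊆ Finset.Icc (u.length + 1) (u.length + v.length)) :
    subword (sc u v) (I ∪ I') =
      subword u I ++ shiftW (wsup u) (subword v (I'.image fun i => i - u.length)) := by
  have hI₁ := fun i hi => Finset.mem_Icc.1 (@hI i hi)
  have hI₂ := fun i hi => Finset.mem_Icc.1 (@hI' i hi)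
  unfold sc shiftW
  rw [← subword_subst (by simp)]
  refine subword_append (fun j hj => ?_) (fun j _ => ?_)
  · rw [Finset.mem_union]
    grind
  · rw [Finset.mem_union, Finset.mem_image]
    constructor
    · rintro (h | h)
      · have := hI₁ _ h
        omega
      · exact ⟨_, h, by omega⟩
    · rintro ⟨i, hi, hij⟩
      have := hI₂ i hi
      obtain rfl : i = u.length + j + 1 := by omega
      exact Or.inr hi

/-- Let `u, v` be words, `I₁ ⊔ J₁ = {1,…,|u|}`,
`I₂ ⊔ J₂ = {|u|+1,…,|u|+|v|}`, and `I'₂ = {i - |u| : i ∈ I₂}`, `J'₂ = {i - |u| : i ∈ J₂}`.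
Then `pack((u*v)[J₁∪J₂] / (u*v)[I₁∪I₂]) = pack(u[J₁]/u[I₁]) * pack(v[J'₂]/v[I'₂])`. -/
theorem pack_quot_subword_sc (u v : Word) (I₁ J₁ I₂ J₂ : Finset ℕ)
    (h₁ : I₁ ∪ J₁ = Finset.Icc 1 u.length) (hd₁ : Disjoint I₁ J₁)
    (h₂ : I₂ ∪ J₂ = Finset.Icc (u.length + 1) (u.length + v.length)) (hd₂ : Disjoint I₂ J₂) :
    pack (quotWord (subword (sc u v) (J₁ ∪ J₂)) (subword (sc u v) (I₁ ∪ I₂)))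
      = sc (pack (quotWord (subword u J₁) (subword u I₁)))
          (pack (quotWord (subword v (J₂.image fun i => i - u.length))
            (subword v (I₂.image fun i => i - u.length)))) := by
  have hI₁ : I₁ ⊆ Finset.Icc 1 u.length := h₁ ▸ Finset.subset_union_left
  have hJ₁ : J₁ ⊆ Finset.Icc 1 u.length := h₁ ▸ Finset.subset_union_right
  rw [subword_sc hJ₁ (h₂ ▸ Finset.subset_union_right),
    subword_sc hI₁ (h₂ ▸ Finset.subset_union_left),
    quotWord_append_shiftW (fun i hi => le_wsup (mem_of_mem_subword hi))
      (fun i hi => le_wsup (mem_of_mem_subword hi))]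
  refine pack_append_shiftW _ fun n hn => ?_
  obtain ⟨i, hi, rfl⟩ := List.mem_map.1 hn
  have := le_wsup (mem_of_mem_subword hi)
  split_ifs <;> omega
end

section
/- For n ≥ 1 and k ≥ 1, the number of packed words of length n with supremum k that contain no occurrence of the letter x₀ equals S(n,k)·k!, where S(n,k) is the Stirling number of the second kind. -/
/-- Stirling numbers of the second kind: `stirling2 n k` is the number of set partitions of
an `n`-element set into exactly `k` nonempty blocks.  They satisfy `S(0,0) = 1`,
`S(n,0) = 0` for `n > 0`, `S(0,k) = 0` for `k > 0`, and
`S(n+1,k+1) = S(n,k) + (k+1)·S(n,k+1)`. -/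
def stirling2 : ℕ → ℕ → ℕ
  | 0, 0 => 1
  | 0, _ + 1 => 0
  | _ + 1, 0 => 0
  | n + 1, k + 1 => stirling2 n k + (k + 1) * stirling2 n (k + 1)

theorem wsup_eq_sup (w : Word) : wsup w = (IAlph w).sup id := by
  induction w with
  | nil => rfl
  | cons a w ih =>
    have h : wsup (a :: w) = max a (wsup w) := rfl
    simp [h, ih, IAlph]

/-- A word is packed exactly when its packing substitution fixes each of its letters. -/
theorem isPacked_iff (w : Word) : IsPacked w ↔ ∀ i ∈ w, packMap w i = i := by
  have h := List.map_inj_left (l := w) (f := packMap w) (g := id)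
  rwa [List.map_id] at h

/-- The packed words without `x₀` of supremum `k` are the words with alphabet `{1, …, k}`. -/
theorem isPacked_and_wsup_eq_and_zero_notMem_iff (w : Word) (k : ℕ) :
    IsPacked w ∧ wsup w = k ∧ 0 ∉ w ↔ w.toFinset = Finset.Icc 1 k := by
  rw [isPacked_iff, wsup_eq_sup]
  constructor
  · rintro ⟨hp, rfl, h0⟩
    have h0' : 0 ∉ IAlph w := by simpa [IAlph] using h0
    have hle : ∀ i ∈ IAlph w, i ≤ (IAlph w).sup id := fun i hi => Finset.le_sup (f := id) hi
    refine Finset.eq_of_subset_of_card_le (fun i hi => ?_) ?_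
    · exact Finset.mem_Icc.2
        ⟨Nat.one_le_iff_ne_zero.2 fun h => h0' (h ▸ hi), hle i hi⟩
    · rw [Nat.card_Icc, Nat.add_sub_cancel]
      rcases (IAlph w).eq_empty_or_nonempty with he | hne
      · simp [he]
      · obtain ⟨i, hi, hsup⟩ := Finset.exists_mem_eq_sup (IAlph w) hne id
        have hfix := hp i (by simpa [IAlph] using hi)
        rw [hsup, id, ← hfix, packMap, Finset.erase_eq_of_notMem h0']
        exact Finset.card_filter_le _ _
  · intro h
    have hmem : ∀ i, i ∈ w ↔ 1 ≤ i ∧ i ≤ k := fun i => by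
      rw [← List.mem_toFinset, h, Finset.mem_Icc]
    refine ⟨fun i hi => ?_, ?_, by simp [hmem]⟩
    · have hf : ((IAlph w).erase 0).filter (fun j => j ≤ i) = Finset.Icc 1 i := by
        ext j
        have := (hmem i).1 hi
        simp only [IAlph, h, Finset.mem_filter, Finset.mem_erase, Finset.mem_Icc]
        omega
      rw [packMap, hf, Nat.card_Icc, Nat.add_sub_cancel]
    · rw [IAlph, h]
      refine le_antisymm (Finset.sup_le fun i hi => (Finset.mem_Icc.1 hi).2) ?_
      rcases Nat.eq_zero_or_pos k with rfl | hk
      · exact Nat.zero_le _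
      · exact Finset.le_sup (f := id) (Finset.mem_Icc.2 ⟨hk, le_rfl⟩)

section ListsOnto

variable {α : Type*} [DecidableEq α]

/-- The lists of length `n` whose set of entries is exactly `s`. -/
def listsOnto : ℕ → Finset α → Finset (List α)
  | 0, s => if s = ∅ then {[]} else ∅
  | n + 1, s => s.biUnion fun a =>
      (listsOnto n s ∪ listsOnto n (s.erase a)).image (List.cons a)

theorem mem_listsOnto (n : ℕ) (s : Finset α) (w : List α) :
    w ∈ listsOnto n s ↔ w.length = n ∧ w.toFinset = s := by
  induction n generalizing s w with
  | zero =>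
    rw [listsOnto]
    split_ifs with h
    · subst h
      cases w <;> simp
    · cases w <;> simp [Ne.symm h]
  | succ n ih =>
    cases w with
    | nil => simp [listsOnto]
    | cons a w =>
      have key : (a ∈ s ∧ (w.toFinset = s ∨ w.toFinset = s.erase a)) ↔
          insert a w.toFinset = s := by
        constructor
        · rintro ⟨ha, h | h⟩
          · rw [h, Finset.insert_eq_of_mem ha]
          · rw [h, Finset.insert_erase ha]
        · rintro rfl
          refine ⟨Finset.mem_insert_self _ _, ?_⟩
          by_cases ha : a ∈ w.toFinset
          · exact Or.inl (Finset.insert_eq_of_mem ha).symm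
          · exact Or.inr (Finset.erase_insert ha).symm
      simp only [listsOnto, Finset.mem_biUnion, Finset.mem_image, Finset.mem_union, ih,
        List.cons.injEq, List.length_cons, List.toFinset_cons, Nat.add_right_cancel_iff, ← key]
      constructor
      · rintro ⟨b, hb, v, hv, rfl, rfl⟩
        tauto
      · rintro ⟨hl, ha, h⟩
        exact ⟨a, ha, w, by tauto, rfl, rfl⟩

theorem card_listsOnto_succ (n : ℕ) (s : Finset α) :
    (listsOnto (n + 1) s).card =
      ∑ a ∈ s, ((listsOnto n s).card + (listsOnto n (s.erase a)).card) := by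
  rw [listsOnto, Finset.card_biUnion]
  · refine Finset.sum_congr rfl fun a ha => ?_
    rw [Finset.card_image_of_injective _ List.cons_injective, Finset.card_union_of_disjoint]
    refine Finset.disjoint_left.2 fun w h₁ h₂ => ?_
    rw [mem_listsOnto] at h₁ h₂
    exact Finset.notMem_erase a s (h₂.2 ▸ h₁.2.symm ▸ ha)
  · intro a _ b _ hab
    refine Finset.disjoint_left.2 fun w h₁ h₂ => ?_
    obtain ⟨u, -, rfl⟩ := Finset.mem_image.1 h₁
    obtain ⟨v, -, h⟩ := Finset.mem_image.1 h₂
    exact hab (List.cons.inj h).1.symm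

theorem card_listsOnto (n : ℕ) (s : Finset α) :
    (listsOnto n s).card = stirling2 n s.card * s.card.factorial := by
  induction n generalizing s with
  | zero =>
    rcases s.eq_empty_or_nonempty with rfl | hs
    · simp [listsOnto, stirling2]
    · obtain ⟨k, hk⟩ := Nat.exists_eq_succ_of_ne_zero hs.card_ne_zero
      simp [listsOnto, hs.ne_empty, hk, stirling2]
  | succ n ih =>
    rw [card_listsOnto_succ]
    rcases hs : s.card with _ | k
    · simp [Finset.card_eq_zero.1 hs, stirling2]
    · have h : ∀ a ∈ s, (listsOnto n s).card + (listsOnto n (s.erase a)).card =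
          stirling2 n (k + 1) * (k + 1).factorial + stirling2 n k * k.factorial := by
        intro a ha
        rw [ih, ih, Finset.card_erase_of_mem ha, hs, Nat.add_sub_cancel]
      rw [Finset.sum_congr rfl h, Finset.sum_const, hs, smul_eq_mul, stirling2,
        Nat.factorial_succ]
      ring

end ListsOnto

/-- For `n ≥ 1`, `k ≥ 1`, the number of packed words of length `n` with
supremum `k` containing no occurrence of the letter `x₀` is `S(n,k)·k!`. -/
theorem card_packed_no_zero (n k : ℕ) (hn : 1 ≤ n) (hk : 1 ≤ k) :
    Nat.card {w : Word // IsPacked w ∧ w.length = n ∧ wsup w = k ∧ (0 : ℕ) ∉ w}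
      = stirling2 n k * Nat.factorial k := by
  have h : ∀ w : Word, (IsPacked w ∧ w.length = n ∧ wsup w = k ∧ (0 : ℕ) ∉ w) ↔
      w ∈ listsOnto n (Finset.Icc 1 k) := fun w => by
    rw [mem_listsOnto, ← isPacked_and_wsup_eq_and_zero_notMem_iff]
    tauto
  rw [Nat.card_congr (Equiv.subtypeEquivRight h), Nat.card_eq_fintype_card, Fintype.card_coe,
    card_listsOnto, Nat.card_Icc, Nat.add_sub_cancel]
end
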